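/- arXiv:1107.2745 — 3 statements merged into one kernel-verified Lean document; each statement's English description precedes it below -/
import Mathlib

section
/- Let A be a commutative group, ψ an automorphism of A, and d ≥ 1 an integer; let Φ be the ψ-twisted shift automorphism of P = ∏_{i=0}^{d−1} A. Let c = (c_0, c_1, …, c_{d−1}) ∈ P and suppose there exists y ∈ A with ψ(y) = y · c_0 · c_1 ⋯ c_{d−1}. Then the element x = (y, y c_0, y c_0 c_1, …, y c_0 c_1 ⋯ c_{d−2}) ∈ P (i.e. x_i = y · ∏_{j<i} c_j for 0 ≤ i ≤ d−1) satisfies Φ(x)·x⁻¹ = c. In particular, c lies in the image of the homomorphism P → P, x ↦ Φ(x)·x⁻¹. -/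
/-- If `Φ` is the `ψ`-twisted shift on `P = ∏_{i=0}^{d-1} A` and
`ψ y = y * c_0 ⋯ c_{d-1}`, then `x_i = y * ∏_{j<i} c_j` satisfies `Φ(x) * x⁻¹ = c`;
in particular `c` is in the image of `x ↦ Φ(x) * x⁻¹`. -/
theorem stmt_1 (A : Type*) [CommGroup A] (ψ : A ≃* A) (d : ℕ) (hd : 1 ≤ d)
    (Φ : (Fin d → A) → (Fin d → A))
    (hΦ : ∀ (x : Fin d → A) (i : Fin d),
      Φ x i = if h : (i : ℕ) + 1 < d then x ⟨(i : ℕ) + 1, h⟩ else ψ (x ⟨0, hd⟩))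
    (c : Fin d → A) (y : A) (hy : ψ y = y * ∏ j, c j) :
    Φ (fun i => y * ∏ j ∈ Finset.Iio i, c j) * (fun i => y * ∏ j ∈ Finset.Iio i, c j)⁻¹ = c ∧
      c ∈ Set.range (fun x : Fin d → A => Φ x * x⁻¹) := by
  have key : Φ (fun i => y * ∏ j ∈ Finset.Iio i, c j) *
      (fun i => y * ∏ j ∈ Finset.Iio i, c j)⁻¹ = c := by
    funext i
    have hI : ∏ j ∈ Finset.Iic i, c j = c i * ∏ j ∈ Finset.Iio i, c j := by
      have h1 : Finset.Iic i = insert i (Finset.Iio i) := by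
        ext j
        simp only [Finset.mem_Iic, Finset.mem_insert, Finset.mem_Iio]
        exact le_iff_eq_or_lt
      rw [h1, Finset.prod_insert (by simp)]
    have hval : Φ (fun i => y * ∏ j ∈ Finset.Iio i, c j) i = y * ∏ j ∈ Finset.Iic i, c j := by
      rw [hΦ]
      split_ifs with h
      · have h2 : Finset.Iio (⟨(i : ℕ) + 1, h⟩ : Fin d) = Finset.Iic i := by
          ext j
          simp only [Finset.mem_Iic, Finset.mem_Iio, Fin.lt_def, Fin.le_def]
          omega
        simp only [h2]
      · have h2 : Finset.Iio (⟨0, hd⟩ : Fin d) = ∅ := by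
          ext j
          simp [Fin.lt_def]
        have h3 : Finset.Iic i = Finset.univ := by
          ext j
          simp only [Finset.mem_Iic, Finset.mem_univ, Fin.le_def, iff_true]
          omega
        simp only [h2, h3, Finset.prod_empty, mul_one, hy]
    rw [Pi.mul_apply, Pi.inv_apply, hval, hI, mul_inv_eq_iff_eq_mul]
    exact mul_left_comm _ _ _
  exact ⟨key, _, key⟩
end

section
/- Let A be a commutative group, ψ an automorphism of A, and v : A → ℤ a surjective group homomorphism (from the multiplicative group A to the additive group ℤ) satisfying v ∘ ψ = v. Assume that every c ∈ A with v(c) = 0 is of the form ψ(y)·y⁻¹ for some y ∈ A. Fix an integer d ≥ 1, let Φ be the ψ-twisted shift automorphism of P = ∏_{i=0}^{d−1} A, and define w : P → ℤ by w(x) = Σ_{i=0}^{d−1} v(x_i). Then: (i) the kernel of w is exactly the set {Φ(x)·x⁻¹ : x ∈ P}; and (ii) an element x ∈ P satisfies Φ(x) = x if and only if x is a constant tuple (a, a, …, a) with ψ(a) = a. -/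
/-- Abstract form of Lemma 2.4 (i) and (ii): for the `ψ`-twisted shift `Φ` on
`P = ∏_{i=0}^{d-1} A` and `w(x) = ∑ v(x_i)`, the kernel of `w` consists exactly of the
elements `Φ(x) * x⁻¹`, and the fixed points of `Φ` are the constant tuples with
`ψ`-fixed entries. -/
theorem stmt_2 (A : Type*) [CommGroup A] (ψ : A ≃* A)
    (v : A → ℤ) (hv_hom : ∀ a b : A, v (a * b) = v a + v b)
    (hv_surj : Function.Surjective v)
    (hvψ : ∀ a : A, v (ψ a) = v a)
    (hcobound : ∀ c : A, v c = 0 → ∃ y : A, ψ y * y⁻¹ = c)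
    (d : ℕ) (hd : 1 ≤ d)
    (Φ : (Fin d → A) → (Fin d → A))
    (hΦ : ∀ (x : Fin d → A) (i : Fin d),
      Φ x i = if h : (i : ℕ) + 1 < d then x ⟨(i : ℕ) + 1, h⟩ else ψ (x ⟨0, hd⟩)) :
    (∀ c : Fin d → A, (∑ i, v (c i)) = 0 ↔ ∃ x : Fin d → A, Φ x * x⁻¹ = c) ∧
      (∀ x : Fin d → A, Φ x = x ↔ ∃ a : A, ψ a = a ∧ x = fun _ => a) := by
  have v1 : v 1 = 0 := by
    have := hv_hom 1 1
    rw [mul_one] at this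
    omega
  have vinv : ∀ a, v a⁻¹ = - v a := by
    intro a
    have := hv_hom a a⁻¹
    rw [mul_inv_cancel, v1] at this
    omega
  obtain ⟨n, rfl⟩ : ∃ n, d = n + 1 := ⟨d - 1, by omega⟩
  have hc : ∀ (x : Fin (n+1) → A) (i : Fin n), Φ x i.castSucc = x i.succ := by
    intro x i
    rw [hΦ, dif_pos (by simp)]
    rfl
  have hl : ∀ (x : Fin (n+1) → A), Φ x (Fin.last n) = ψ (x 0) := by
    intro x
    rw [hΦ, dif_neg (by simp)]
    rfl
  refine ⟨fun c => ⟨fun h => ?_, ?_⟩, fun x => ⟨fun h => ?_, ?_⟩⟩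
  · let C : ℕ → A := fun k => if h : k < n + 1 then c ⟨k, h⟩ else 1
    have hC : ∀ i : Fin (n+1), C i = c i := fun i => dif_pos i.2
    have hvp : ∀ m, v (∏ j ∈ Finset.range m, C j) = ∑ j ∈ Finset.range m, v (C j) := by
      intro m
      induction m with
      | zero => simpa using v1
      | succ m ih => rw [Finset.prod_range_succ, Finset.sum_range_succ, hv_hom, ih]
    obtain ⟨y, hy⟩ := hcobound (∏ j ∈ Finset.range (n+1), C j) (by
      rw [hvp, Finset.sum_range]
      simpa only [hC] using h)
    refine ⟨fun k => y * ∏ j ∈ Finset.range k, C j, ?_⟩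
    funext i
    rw [Pi.mul_apply, Pi.inv_apply, mul_inv_eq_iff_eq_mul]
    induction i using Fin.lastCases with
    | last =>
      rw [hl, ← hC]
      rw [mul_inv_eq_iff_eq_mul, Finset.prod_range_succ] at hy
      simp only [Fin.val_zero, Finset.range_zero, Finset.prod_empty, mul_one, hy, Fin.val_last]
      simp only [mul_comm, mul_left_comm, mul_assoc]
    | cast i =>
      rw [hc, ← hC]
      simp only [Fin.val_succ, Fin.val_castSucc, Finset.prod_range_succ]
      simp only [mul_comm, mul_left_comm, mul_assoc]
  · rintro ⟨x, rfl⟩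
    simp only [Pi.mul_apply, Pi.inv_apply, hv_hom, vinv, Finset.sum_add_distrib,
      Finset.sum_neg_distrib]
    rw [Fin.sum_univ_castSucc, Fin.sum_univ_succ (fun i => v (x i))]
    simp only [hc, hl, hvψ]
    ring
  · have hx : ∀ i, x i = x 0 := by
      intro i
      induction i using Fin.induction with
      | zero => rfl
      | succ i ih => rw [← hc x i, h, ih]
    exact ⟨x 0, by rw [← hl x, h, hx], funext hx⟩
  · rintro ⟨a, ha, rfl⟩
    funext i
    induction i using Fin.lastCases with
    | last => rw [hl, ha]
    | cast i => rw [hc]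
end

section
/- Let Ω be a field, K a subfield of Ω, and let L and M be intermediate fields of Ω/K that are finite extensions of K, such that M/K is a Galois extension whose Galois group is cyclic, generated by φ. Set E = L ∩ M and d = [E : K], and let LM denote the compositum of L and M inside Ω. Then the K-algebra homomorphism M ⊗_K L → ∏_{i=0}^{d−1} LM determined on elementary tensors by a ⊗ b ↦ (a b, φ(a) b, φ²(a) b, …, φ^{d−1}(a) b) is an isomorphism of K-algebras. -/
open TensorProduct

open IntermediateField in
theorem aux_finrank {K Ω : Type*} [Field K] [Field Ω] [Algebra K Ω]
    (L M : IntermediateField K Ω)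
    [FiniteDimensional K L] [FiniteDimensional K M] [IsGalois K M] :
    Module.finrank K M * Module.finrank K L =
      Module.finrank K ↥(L ⊓ M) * Module.finrank K ↥(L ⊔ M) := by
  have hL : L ⊓ M ≤ L := inf_le_left
  have hM : L ⊓ M ≤ M := inf_le_right
  have g0 : IsGalois K (extendScalars hM) := (inferInstance : IsGalois K M)
  have g1 : IsGalois ↥(L ⊓ M) (extendScalars hM) :=
    IsGalois.tower_top_of_isGalois K ↥(L ⊓ M) (extendScalars hM)
  have f0 : FiniteDimensional K (extendScalars hM) := (inferInstance : FiniteDimensional K M)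
  have f1 : FiniteDimensional K (extendScalars hL) := (inferInstance : FiniteDimensional K L)
  have f2 : FiniteDimensional ↥(L ⊓ M) (extendScalars hM) :=
    FiniteDimensional.right K ↥(L ⊓ M) (extendScalars hM)
  have f3 : FiniteDimensional ↥(L ⊓ M) (extendScalars hL) :=
    FiniteDimensional.right K ↥(L ⊓ M) (extendScalars hL)
  have hd : (extendScalars hM).LinearDisjoint (extendScalars hL) := by
    apply LinearDisjoint.of_inf_eq_bot
    rw [extendScalars_inf, ← extendScalars_self]
    ext x
    rw [mem_extendScalars, mem_extendScalars, inf_comm]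
  have h := hd.finrank_sup
  rw [extendScalars_sup] at h
  have e1 := finrank_bot_mul_relfinrank hM
  have e2 := finrank_bot_mul_relfinrank hL
  have e3 := finrank_bot_mul_relfinrank (le_sup_of_le_left hM : L ⊓ M ≤ M ⊔ L)
  rw [relfinrank_eq_finrank_of_le hM] at e1
  rw [relfinrank_eq_finrank_of_le hL] at e2
  rw [relfinrank_eq_finrank_of_le (le_sup_of_le_left hM : L ⊓ M ≤ M ⊔ L)] at e3
  rw [sup_comm L M, ← e1, ← e2, ← e3, h]
  ring

/-- distinctness of the powers on the intersection -/
theorem aux_distinct {K M : Type*} [Field K] [Field M] [Algebra K M] [FiniteDimensional K M]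
    [IsGalois K M] (φ : M ≃ₐ[K] M) (hφ : ∀ σ : M ≃ₐ[K] M, σ ∈ Subgroup.zpowers φ)
    (E : IntermediateField K M) (i j : ℕ) (hi : i < Module.finrank K E)
    (hj : j < Module.finrank K E) (h : ∀ e ∈ E, (φ ^ i) e = (φ ^ j) e) : i = j := by
  have hcomm : ∀ a b : M ≃ₐ[K] M, a * b = b * a := by
    intro a b
    obtain ⟨m, rfl⟩ := hφ a
    obtain ⟨n, rfl⟩ := hφ b
    exact (zpow_mul_comm φ m n)
  have hN : E.fixingSubgroup.Normal := ⟨fun n hn g => by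
    rwa [hcomm g n, mul_inv_cancel_right]⟩
  have ho : orderOf (φ : (M ≃ₐ[K] M) ⧸ E.fixingSubgroup) = Module.finrank K E := by
    rw [IntermediateField.finrank_eq_fixingSubgroup_index]
    apply orderOf_eq_card_of_forall_mem_zpowers
    intro x
    obtain ⟨σ, rfl⟩ := QuotientGroup.mk_surjective x
    obtain ⟨n, rfl⟩ := hφ σ
    exact ⟨n, by simp⟩
  rw [← ho] at hi hj
  apply pow_injOn_Iio_orderOf hi hj
  simp only
  rw [← QuotientGroup.mk_pow, ← QuotientGroup.mk_pow, QuotientGroup.eq,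
    IntermediateField.mem_fixingSubgroup_iff]
  intro e he
  rw [AlgEquiv.mul_apply, ← h e he, ← AlgEquiv.mul_apply, inv_mul_cancel, AlgEquiv.one_apply]

theorem aux_stable {K M : Type*} [Field K] [Field M] [Algebra K M] [FiniteDimensional K M]
    [IsGalois K M] (φ : M ≃ₐ[K] M) (hφ : ∀ σ : M ≃ₐ[K] M, σ ∈ Subgroup.zpowers φ)
    (E : IntermediateField K M) (i : ℕ) (e : M) (he : e ∈ E) : (φ ^ i) e ∈ E := by
  rw [← IsGalois.fixedField_fixingSubgroup E, IntermediateField.mem_fixedField_iff]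
  intro σ hσ
  have hc : σ * φ ^ i = φ ^ i * σ := by
    obtain ⟨m, rfl⟩ := hφ σ
    exact (Commute.zpow_left (Commute.refl φ) m).pow_right i
  rw [← AlgEquiv.mul_apply, hc, AlgEquiv.mul_apply,
    (IntermediateField.mem_fixingSubgroup_iff _ _).1 hσ e he]

/-- the component maps -/
noncomputable def auxMap {K Ω : Type*} [Field K] [Field Ω] [Algebra K Ω]
    (L M : IntermediateField K Ω) (σ : M ≃ₐ[K] M) : (M ⊗[K] L) →ₐ[K] ↥(L ⊔ M) :=
  Algebra.TensorProduct.productMap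
    ((IntermediateField.inclusion (le_sup_right : M ≤ L ⊔ M)).comp σ.toAlgHom)
    (IntermediateField.inclusion (le_sup_left : L ≤ L ⊔ M))

theorem auxMap_tmul {K Ω : Type*} [Field K] [Field Ω] [Algebra K Ω]
    (L M : IntermediateField K Ω) (σ : M ≃ₐ[K] M) (a : M) (b : L) :
    auxMap L M σ (a ⊗ₜ b) = IntermediateField.inclusion (le_sup_right : M ≤ L ⊔ M) (σ a) *
            IntermediateField.inclusion (le_sup_left : L ≤ L ⊔ M) b := by
  simp [auxMap]

theorem auxMap_surj {K Ω : Type*} [Field K] [Field Ω] [Algebra K Ω]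
    (L M : IntermediateField K Ω) [FiniteDimensional K L] (σ : M ≃ₐ[K] M) :
    Function.Surjective (auxMap L M σ) := by
  have hle : L.toSubalgebra ⊔ M.toSubalgebra ≤
      (auxMap L M σ).range.map (L ⊔ M).val := by
    refine sup_le ?_ ?_
    · intro x hx
      refine ⟨_, ⟨1 ⊗ₜ ⟨x, hx⟩, rfl⟩, ?_⟩
      simp [auxMap]
    · intro x hx
      refine ⟨_, ⟨σ.symm ⟨x, hx⟩ ⊗ₜ 1, rfl⟩, ?_⟩
      simp [auxMap]
  rw [← IntermediateField.sup_toSubalgebra_of_left] at hle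
  rintro ⟨y, hy⟩
  obtain ⟨z, ⟨t, ht⟩, hz⟩ := hle hy
  exact ⟨t, Subtype.ext ((congrArg Subtype.val ht).trans hz)⟩

theorem aux_crt {K R S ι : Type*} [Field K] [CommRing R] [Field S] [Algebra K R] [Algebra K S]
    [Finite ι] (f : ι → R →ₐ[K] S)
    (hf : ∀ i, Function.Surjective (f i))
    (hne : ∀ i j, (∀ x, f i x = 0 → f j x = 0) → i = j) (y : ι → S) :
    ∃ r, ∀ i, f i r = y i := by
  have hmax : ∀ i, (RingHom.ker (f i)).IsMaximal := fun i =>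
    RingHom.ker_isMaximal_of_surjective (f i) (hf i)
  have hcop : Pairwise (Function.onFun IsCoprime fun i => RingHom.ker (f i)) := by
    intro i j hij
    exact Ideal.isCoprime_of_isMaximal (fun heq => hij (hne i j fun x hx => by
      have : x ∈ RingHom.ker (f i) := hx
      exact (SetLike.ext_iff.1 heq x).1 this))
  choose t ht using fun i => hf i (y i)
  obtain ⟨r, hr⟩ := Ideal.pi_quotient_surjective hcop (fun i => Ideal.Quotient.mk _ (t i))
  refine ⟨r, fun i => ?_⟩
  have h1 := Ideal.Quotient.eq.1 (hr i)
  rw [RingHom.mem_ker, map_sub, sub_eq_zero] at h1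
  exact h1.trans (ht i)

theorem aux_crt2 {K A B S ι : Type*} [Field K] [Field A] [Field B] [Field S] [Algebra K A]
    [Algebra K B] [Algebra K S]
    [Finite ι] (f : ι → (A ⊗[K] B) →ₐ[K] S)
    (hf : ∀ i, Function.Surjective (f i))
    (hne : ∀ i j, (∀ x, f i x = 0 → f j x = 0) → i = j) (y : ι → S) :
    ∃ r, ∀ i, f i r = y i := aux_crt f hf hne y

/-- Finite-level form of Lemma 2.1(i): if `M/K` is finite Galois with cyclic Galois group
generated by `φ`, `L/K` finite, `E = L ⊓ M` of degree `d`, then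
`M ⊗_K L ≅ ∏_{i=0}^{d-1} LM` via `a ⊗ b ↦ (φ^i(a)·b)_i` as `K`-algebras. -/
theorem stmt_4 (K Ω : Type*) [Field K] [Field Ω] [Algebra K Ω]
    (L M : IntermediateField K Ω)
    [FiniteDimensional K L] [FiniteDimensional K M]
    [IsGalois K M]
    (φ : ↥M ≃ₐ[K] ↥M) (hφ : ∀ σ : ↥M ≃ₐ[K] ↥M, σ ∈ Subgroup.zpowers φ) :
    ∃ F : (↥M ⊗[K] ↥L) ≃ₐ[K] (Fin (Module.finrank K ↥(L ⊓ M)) → ↥(L ⊔ M)),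
      ∀ (a : ↥M) (b : ↥L) (i : Fin (Module.finrank K ↥(L ⊓ M))),
        F (a ⊗ₜ[K] b) i =
          IntermediateField.inclusion (le_sup_right : M ≤ L ⊔ M) ((φ ^ (i : ℕ)) a) *
            IntermediateField.inclusion (le_sup_left : L ≤ L ⊔ M) b := by
  classical
  let f : Fin (Module.finrank K ↥(L ⊓ M)) → ((↥M ⊗[K] ↥L) →ₐ[K] ↥(L ⊔ M)) :=
    fun i => auxMap L M (φ ^ (i : ℕ))
  let E : IntermediateField K M := IntermediateField.restrict (inf_le_right : L ⊓ M ≤ M)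
  have hE : Module.finrank K E = Module.finrank K ↥(L ⊓ M) :=
    (IntermediateField.restrictAlgEquiv (inf_le_right : L ⊓ M ≤ M)).toLinearEquiv.finrank_eq.symm
  have hne : ∀ i j, (∀ x, f i x = 0 → f j x = 0) → i = j := by
    intro i j heq
    refine Fin.ext (aux_distinct φ hφ E i j (i.2.trans_eq hE.symm) (j.2.trans_eq hE.symm) fun e he => ?_)
    have hs := aux_stable φ hφ E i e he
    have hs' : (((φ ^ (i : ℕ)) e : M) : Ω) ∈ L :=
      ((IntermediateField.mem_restrict (inf_le_right : L ⊓ M ≤ M) _).1 hs).1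
    have h1 : f i (e ⊗ₜ[K] (1 : L) - (1 : M) ⊗ₜ[K] (⟨_, hs'⟩ : L)) = 0 := by
      rw [map_sub, sub_eq_zero]
      simp only [f, auxMap_tmul]
      apply Subtype.ext
      simp
    replace h1 := heq _ h1
    rw [map_sub, sub_eq_zero] at h1
    simp only [f, auxMap_tmul] at h1
    have h2 := congrArg (Subtype.val) h1
    simp only [map_one, mul_one, one_mul] at h2
    exact Subtype.ext h2.symm
  have hfs : ∀ i, Function.Surjective (f i) := fun i => auxMap_surj L M (φ ^ (i : ℕ))
  let F : (↥M ⊗[K] ↥L) →ₐ[K] (Fin (Module.finrank K ↥(L ⊓ M)) → ↥(L ⊔ M)) :=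
    AlgHom.pi f
  have hsurj : Function.Surjective F := by
    intro y
    obtain ⟨r, hr⟩ := aux_crt2 (K := K) (A := M) (B := L) (S := ↥(L ⊔ M))
      (ι := Fin (Module.finrank K ↥(L ⊓ M))) f hfs hne y
    exact ⟨r, funext hr⟩
  have hdim : Module.finrank K (↥M ⊗[K] ↥L) =
      Module.finrank K (Fin (Module.finrank K ↥(L ⊓ M)) → ↥(L ⊔ M)) := by
    rw [Module.finrank_tensorProduct, Module.finrank_pi_fintype, aux_finrank]
    simp
  have hinj : Function.Injective F :=
    (LinearMap.injective_iff_surjective_of_finrank_eq_finrank (f := F.toLinearMap) hdim).2 hsurj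
  exact ⟨AlgEquiv.ofBijective F ⟨hinj, hsurj⟩, fun a b i => auxMap_tmul L M _ a b⟩
end
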